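/- There exist constants δ, D > 0 such that the following holds for Thompson's group V. For all g1, g2 ∈ V with N(g1) ≥ 4 and N(g2) ≥ 4, there is a word w in the letters {x0^{±1}, x1^{±1}, c1^{±1}, π0^{±1}} of length at most D·(|g1|_C + |g2|_C) such that g1·w = g2 as elements of V, and for every prefix w' of w (evaluated as an element of V) one has |g1·w'|_C ≥ δ·min{|g1|_C, |g2|_C}. -/

import Mathlib

/-!
Formalization framework for Thompson's groups `F ≤ T ≤ V` acting on the
Cantor set `{0,1}^ℕ`.  Elements of `V` are permutations of the Cantor set
admitting a finite table of branches `u → v` (complete prefix codes) with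
`g(uω) = vω`.  Products in the paper are composed left-to-right, i.e. the
paper's `g·h` is `Equiv.trans g h` (equivalently `h * g` in `Equiv.Perm`).
-/

abbrev CSeq : Type := ℕ → Bool
abbrev VPerm : Type := Equiv.Perm CSeq

/-- Concatenation of a finite binary word with an infinite binary word. -/
def app (u : List Bool) (ω : CSeq) : CSeq := fun n =>
  if h : n < u.length then u[n] else ω (n - u.length)

/-- The finite word `u` is a prefix of the infinite word `ω`. -/
def IsPref (u : List Bool) (ω : CSeq) : Prop := ∃ ω', ω = app u ω'

/-- The finite table of branches `T` represents the permutation `g` of the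
Cantor set: the domain codes and the range codes each form a complete prefix
code, and `g` maps `uω ↦ vω` for every branch `(u, v) ∈ T`. -/
def Represents (g : VPerm) (T : Finset (List Bool × List Bool)) : Prop :=
  (∀ ω : CSeq, ∃! p : List Bool × List Bool, p ∈ T ∧ IsPref p.1 ω) ∧
  (∀ ω : CSeq, ∃! p : List Bool × List Bool, p ∈ T ∧ IsPref p.2 ω) ∧
  (∀ p ∈ T, ∀ ω : CSeq, g (app p.1 ω) = app p.2 ω)

/-- A table of branches is reduced if it contains no pair of branches
`u0 → v0`, `u1 → v1`. -/
def Reduced (T : Finset (List Bool × List Bool)) : Prop :=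
  ∀ u v : List Bool,
    ¬((u ++ [false], v ++ [false]) ∈ T ∧ (u ++ [true], v ++ [true]) ∈ T)

/-- Membership in Thompson's group `V`. -/
def InV (g : VPerm) : Prop := ∃ T, Represents g T

/-- `u → v` is a branch of the (unique) reduced representation of `g`. -/
def IsBranch (g : VPerm) (u v : List Bool) : Prop :=
  ∃ T, Represents g T ∧ Reduced T ∧ (u, v) ∈ T

/-- `N(g)`: the number of branches of the reduced representation of `g`. -/
noncomputable def Nbr (g : VPerm) : ℕ :=
  sInf {n | ∃ T, Represents g T ∧ Reduced T ∧ T.card = n}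

/-- `ℓ0(g)`: the unique `ℓ ≥ 1` such that `0^ℓ` is the range code of some
branch of `g`. -/
noncomputable def ell0 (g : VPerm) : ℕ :=
  sInf {ℓ | 1 ≤ ℓ ∧ ∃ u, IsBranch g u (List.replicate ℓ false)}

/-- `ℓ1(g)`: the unique `ℓ ≥ 1` such that `1^ℓ` is the range code of some
branch of `g`. -/
noncomputable def ell1 (g : VPerm) : ℕ :=
  sInf {ℓ | 1 ≤ ℓ ∧ ∃ u, IsBranch g u (List.replicate ℓ true)}

/-- `w` is a strict prefix of the range code of some branch of `g`. -/
def StrictPrefOfBranch (g : VPerm) (w : List Bool) : Prop :=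
  ∃ u v, IsBranch g u v ∧ w <+: v ∧ w ≠ v

/-- Strict lexicographic order on infinite binary words. -/
def lexLt (a b : CSeq) : Prop :=
  ∃ n, (∀ i < n, a i = b i) ∧ a n = false ∧ b n = true

/-- Membership in Thompson's group `F`: an element of `V` preserving the
(lexicographic) order of the Cantor set. -/
def InF (g : VPerm) : Prop :=
  InV g ∧ ∀ a b : CSeq, lexLt a b → lexLt (g a) (g b)

/-- `(a, b, c)` is a (strict) cyclically ordered triple. -/
def cyc3 (a b c : CSeq) : Prop :=
  (lexLt a b ∧ lexLt b c) ∨ (lexLt b c ∧ lexLt c a) ∨ (lexLt c a ∧ lexLt a b)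

/-- Membership in Thompson's group `T`: an element of `V` preserving the
cyclic order of the Cantor set. -/
def InT (g : VPerm) : Prop :=
  InV g ∧ ∀ a b c : CSeq, cyc3 a b c → cyc3 (g a) (g b) (g c)

/-- Word length of `g` with respect to the generating set `S` (letters are
elements of `S` or inverses of elements of `S`). -/
noncomputable def wlen (S : Set VPerm) (g : VPerm) : ℕ :=
  sInf {n | ∃ l : List VPerm,
    l.length = n ∧ (∀ x ∈ l, x ∈ S ∨ x⁻¹ ∈ S) ∧ l.prod = g}

/-- `h'` is the copy `h_{[u]}` of `h` supported on the cylinder of `u`. -/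
def IsCopy (h : VPerm) (u : List Bool) (h' : VPerm) : Prop :=
  (∀ ω : CSeq, h' (app u ω) = app u (h ω)) ∧
  (∀ ω : CSeq, ¬ IsPref u ω → h' ω = ω)

/-- Evaluation (left-to-right) of the word `w` starting at the element `g`:
the paper's product `g · w`. -/
def wordEval (g : VPerm) (w : List VPerm) : VPerm :=
  w.foldl (fun a b => a.trans b) g

/-- Branches of the generator `x0`: `00→0`, `01→10`, `1→11`. -/
def x0T : Finset (List Bool × List Bool) :=
  {([false, false], [false]), ([false, true], [true, false]),
   ([true], [true, true])}

/-- Branches of the generator `x1`: `0→0`, `100→10`, `101→110`, `11→111`. -/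
def x1T : Finset (List Bool × List Bool) :=
  {([false], [false]), ([true, false, false], [true, false]),
   ([true, false, true], [true, true, false]),
   ([true, true], [true, true, true])}

/-- Branches of the generator `c1`: `0→10`, `10→11`, `11→0`. -/
def c1T : Finset (List Bool × List Bool) :=
  {([false], [true, false]), ([true, false], [true, true]),
   ([true, true], [false])}

/-- Branches of the generator `π0`: `0→10`, `10→0`, `11→11`. -/
def pi0T : Finset (List Bool × List Bool) :=
  {([false], [true, false]), ([true, false], [false]),
   ([true, true], [true, true])}

/-- The standard generators `x_j`, `j ≥ 0`, of `F`: for `r ≥ 1`,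
`x_{r+1} = x0^{-r} · x1 · x0^{r}` in the left-to-right convention of the
paper, i.e. `x0 ^ r * x1 * (x0⁻¹) ^ r` in `Equiv.Perm`. -/
def xseq (x0 x1 : VPerm) : ℕ → VPerm
  | 0 => x0
  | r + 1 => x0 ^ r * x1 * (x0⁻¹) ^ r

lemma app_nil (ω : CSeq) : app [] ω = ω := by
  funext n; simp [app]

lemma app_append (u v : List Bool) (ω : CSeq) : app (u ++ v) ω = app u (app v ω) := by
  funext n
  simp only [app, List.length_append]
  by_cases h1 : n < u.length
  · simp [h1, Nat.lt_add_right]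
  · by_cases h2 : n - u.length < v.length
    · have h3 : n < u.length + v.length := by omega
      simp [h1, h2, h3, List.getElem_append_right (not_lt.mp h1)]
    · have h3 : ¬ n < u.length + v.length := by omega
      simp [h1, h2, h3, Nat.sub_sub]

lemma app_apply_lt (u : List Bool) (ω : CSeq) {n : ℕ} (h : n < u.length) :
    app u ω n = u[n] := by simp [app, h]

lemma app_apply_add (u : List Bool) (ω : CSeq) (n : ℕ) : app u ω (u.length + n) = ω n := by
  simp [app]

lemma prefix_or_of_app_eq {u v : List Bool} {a b : CSeq} (h : app u a = app v b)
    (hl : u.length ≤ v.length) : u <+: v := by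
  rw [List.prefix_iff_eq_take]
  apply List.ext_getElem
  · simp [hl]
  · intro n h1 h2
    have := congrFun h n
    rw [app_apply_lt _ _ h1, app_apply_lt _ _ (by omega)] at this
    simpa using this

lemma isPref_app (u : List Bool) (ω : CSeq) : IsPref u (app u ω) := ⟨ω, rfl⟩

lemma IsPref.of_prefix {u v : List Bool} {ω : CSeq} (h : u <+: v) (hv : IsPref v ω) :
    IsPref u ω := by
  obtain ⟨t, rfl⟩ := h
  obtain ⟨ω', rfl⟩ := hv
  exact ⟨app t ω', app_append _ _ _⟩

lemma IsPref.prefix_of_length_le {u v : List Bool} {ω : CSeq} (hu : IsPref u ω)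
    (hv : IsPref v ω) (hl : u.length ≤ v.length) : u <+: v := by
  obtain ⟨a, rfl⟩ := hu
  obtain ⟨b, hb⟩ := hv
  exact prefix_or_of_app_eq hb hl

lemma exists_cons (ω : CSeq) : ∃ ω', ω = app [ω 0] ω' := by
  refine ⟨fun n => ω (n + 1), ?_⟩
  funext n
  cases n <;> simp [app]

/-- `g` replaces the prefix `u` by `v`. -/
def Maps (g : VPerm) (u v : List Bool) : Prop := ∀ ω, g (app u ω) = app v ω

lemma Maps.append {g : VPerm} {u v : List Bool} (h : Maps g u v) (s : List Bool) :
    Maps g (u ++ s) (v ++ s) := by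
  intro ω; rw [app_append, app_append, h]

lemma Maps.mul {g h : VPerm} {u v w : List Bool} (hh : Maps h v w) (hg : Maps g u v) :
    Maps (h * g) u w := by
  intro ω; rw [Equiv.Perm.mul_apply, hg, hh]

lemma Maps.inv {g : VPerm} {u v : List Bool} (hg : Maps g u v) : Maps g⁻¹ v u := by
  intro ω; rw [Equiv.Perm.inv_eq_iff_eq, hg]

/-- The four permutations with the tables of the standard generators. -/
structure IsGens (x0 x1 c1 pi0 : VPerm) : Prop where
  x0 : Represents x0 x0T
  x1 : Represents x1 x1T
  c1 : Represents c1 c1T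
  pi0 : Represents pi0 pi0T

namespace IsGens

variable {x0 x1 c1 pi0 : VPerm} (H : IsGens x0 x1 c1 pi0)
include H

lemma x0_00 (s : List Bool) : Maps x0 (false :: false :: s) (false :: s) :=
  Maps.append (u := [false, false]) (v := [false]) (H.x0.2.2 (_, _) (by simp [x0T])) s

lemma x0_01 (s : List Bool) : Maps x0 (false :: true :: s) (true :: false :: s) :=
  Maps.append (u := [false, true]) (v := [true, false]) (H.x0.2.2 (_, _) (by simp [x0T])) s

lemma x0_1 (s : List Bool) : Maps x0 (true :: s) (true :: true :: s) :=
  Maps.append (u := [true]) (v := [true, true]) (H.x0.2.2 (_, _) (by simp [x0T])) s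

lemma x1_0 (s : List Bool) : Maps x1 (false :: s) (false :: s) :=
  Maps.append (u := [false]) (v := [false]) (H.x1.2.2 (_, _) (by simp [x1T])) s

lemma x1_100 (s : List Bool) : Maps x1 (true :: false :: false :: s) (true :: false :: s) :=
  Maps.append (u := [true, false, false]) (v := [true, false])
    (H.x1.2.2 (_, _) (by simp [x1T])) s

lemma x1_11 (s : List Bool) : Maps x1 (true :: true :: s) (true :: true :: true :: s) :=
  Maps.append (u := [true, true]) (v := [true, true, true])
    (H.x1.2.2 (_, _) (by simp [x1T])) s

lemma c1_0 (s : List Bool) : Maps c1 (false :: s) (true :: false :: s) :=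
  Maps.append (u := [false]) (v := [true, false]) (H.c1.2.2 (_, _) (by simp [c1T])) s

lemma c1_10 (s : List Bool) : Maps c1 (true :: false :: s) (true :: true :: s) :=
  Maps.append (u := [true, false]) (v := [true, true]) (H.c1.2.2 (_, _) (by simp [c1T])) s

lemma c1_11 (s : List Bool) : Maps c1 (true :: true :: s) (false :: s) :=
  Maps.append (u := [true, true]) (v := [false]) (H.c1.2.2 (_, _) (by simp [c1T])) s

lemma pi0_0 (s : List Bool) : Maps pi0 (false :: s) (true :: false :: s) :=
  Maps.append (u := [false]) (v := [true, false]) (H.pi0.2.2 (_, _) (by simp [pi0T])) s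

lemma pi0_10 (s : List Bool) : Maps pi0 (true :: false :: s) (false :: s) :=
  Maps.append (u := [true, false]) (v := [false]) (H.pi0.2.2 (_, _) (by simp [pi0T])) s

lemma pi0_11 (s : List Bool) : Maps pi0 (true :: true :: s) (true :: true :: s) :=
  Maps.append (u := [true, true]) (v := [true, true]) (H.pi0.2.2 (_, _) (by simp [pi0T])) s

end IsGens

/-- `s` exchanges the cylinders of `u` and `v` and fixes everything else. -/
def IsSwap (s : VPerm) (u v : List Bool) : Prop :=
  Maps s u v ∧ Maps s v u ∧ ∀ ω, ¬ IsPref u ω → ¬ IsPref v ω → s ω = ω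

lemma IsSwap.symm {s : VPerm} {u v : List Bool} (h : IsSwap s u v) : IsSwap s v u :=
  ⟨h.2.1, h.1, fun ω h1 h2 => h.2.2 ω h2 h1⟩

/-- Some element of `G` is the swap of the cylinders of `u` and `v`. -/
def HasSwap (G : Subgroup VPerm) (u v : List Bool) : Prop := ∃ s ∈ G, IsSwap s u v

lemma HasSwap.symm {G : Subgroup VPerm} {u v : List Bool} (h : HasSwap G u v) :
    HasSwap G v u := by
  obtain ⟨s, hs, h⟩ := h
  exact ⟨s, hs, h.symm⟩

lemma HasSwap.of_maps {G : Subgroup VPerm} {f : VPerm} (hf : f ∈ G) {u v u' v' : List Bool}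
    (hu : Maps f u u') (hv : Maps f v v') (h : HasSwap G u' v') : HasSwap G u v := by
  obtain ⟨s, hs, h1, h2, h3⟩ := h
  refine ⟨f⁻¹ * s * f, G.mul_mem (G.mul_mem (G.inv_mem hf) hs) hf,
    (hv.inv.mul h1).mul hu, (hu.inv.mul h2).mul hv, fun ω hω hω' => ?_⟩
  have key : ∀ {a b : List Bool}, Maps f a b → ¬ IsPref a ω → ¬ IsPref b (f ω) := by
    rintro a b hab hn ⟨ζ, hζ⟩
    exact hn ⟨ζ, by rw [← hab, EmbeddingLike.apply_eq_iff_eq] at hζ; exact hζ⟩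
  simp only [Equiv.Perm.mul_apply]
  rw [h3 _ (key hu hω) (key hv hω')]
  simp

/-- The subgroup generated by the standard generators. -/
def genGroup (x0 x1 c1 pi0 : VPerm) : Subgroup VPerm :=
  Subgroup.closure {x0, x1, c1, pi0}

section genGroup

variable {x0 x1 c1 pi0 : VPerm}

lemma x0_mem : x0 ∈ genGroup x0 x1 c1 pi0 := Subgroup.subset_closure (by simp)
lemma x1_mem : x1 ∈ genGroup x0 x1 c1 pi0 := Subgroup.subset_closure (by simp)
lemma c1_mem : c1 ∈ genGroup x0 x1 c1 pi0 := Subgroup.subset_closure (by simp)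
lemma pi0_mem : pi0 ∈ genGroup x0 x1 c1 pi0 := Subgroup.subset_closure (by simp)

variable (H : IsGens x0 x1 c1 pi0)
include H

lemma isSwap_pi0 : IsSwap pi0 [false] [true, false] := by
  refine ⟨H.pi0_0 [], H.pi0_10 [], fun ω h1 h2 => ?_⟩
  obtain ⟨⟨⟨p, q⟩, ⟨hp, ⟨ζ, rfl⟩⟩, -⟩, -⟩ := H.pi0.1 ω, trivial
  simp only [pi0T, Finset.mem_insert, Finset.mem_singleton, Prod.mk.injEq] at hp
  obtain ⟨rfl, rfl⟩ | ⟨rfl, rfl⟩ | ⟨rfl, rfl⟩ := hp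
  · exact (h1 (isPref_app _ _)).elim
  · exact (h2 (isPref_app _ _)).elim
  · exact H.pi0_11 [] ζ

lemma isSwap_halves : IsSwap (c1 * x0) [false] [true] := by
  have h1 : Maps (c1 * x0) [true] [false] := (H.c1_11 []).mul (H.x0_1 [])
  have h0 : Maps (c1 * x0) [false] [true] := by
    intro ω
    obtain ⟨ζ, rfl⟩ | ⟨ζ, rfl⟩ : (∃ ζ, ω = app [false] ζ) ∨ ∃ ζ, ω = app [true] ζ := by
      obtain ⟨ζ, h⟩ := exists_cons ω
      cases hb : ω 0 <;> rw [hb] at h <;> simp [h]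
    · rw [← app_append, ← app_append]
      exact (H.c1_0 []).mul (H.x0_00 []) ζ
    · rw [← app_append, ← app_append]
      exact (H.c1_10 []).mul (H.x0_01 []) ζ
  refine ⟨h0, h1, fun ω h2 h3 => ?_⟩
  obtain ⟨ζ, h⟩ := exists_cons ω
  cases hb : ω 0 <;> rw [hb] at h
  · exact (h2 ⟨ζ, h⟩).elim
  · exact (h3 ⟨ζ, h⟩).elim

lemma exists_maps_of_two_letters (a b : Bool) (s t : List Bool) :
    ∃ f ∈ genGroup x0 x1 c1 pi0,
      Maps f (a :: b :: s) (false :: s) ∧ Maps f (a :: b :: t) (false :: t) := by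
  cases a <;> cases b
  · exact ⟨_, x0_mem, H.x0_00 s, H.x0_00 t⟩
  · exact ⟨_, mul_mem pi0_mem x0_mem, (H.pi0_10 s).mul (H.x0_01 s),
      (H.pi0_10 t).mul (H.x0_01 t)⟩
  · exact ⟨_, pi0_mem, H.pi0_10 s, H.pi0_10 t⟩
  · exact ⟨_, c1_mem, H.c1_11 s, H.c1_11 t⟩

lemma exists_maps_of_ne_two_letters (a b c d : Bool) (s t : List Bool)
    (h : ¬ (a = c ∧ b = d)) :
    ∃ f ∈ genGroup x0 x1 c1 pi0,
      (Maps f (a :: b :: s) (false :: s) ∧ Maps f (c :: d :: t) (true :: false :: t)) ∨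
      (Maps f (a :: b :: s) (true :: false :: s) ∧ Maps f (c :: d :: t) (false :: t)) := by
  have h0001 : ∀ s t : List Bool, Maps x0 (false :: false :: s) (false :: s) ∧
      Maps x0 (false :: true :: t) (true :: false :: t) :=
    fun s t => ⟨H.x0_00 s, H.x0_01 t⟩
  have h0010 : ∀ s t : List Bool,
      Maps (x1 * pi0) (false :: false :: s) (true :: false :: s) ∧
      Maps (x1 * pi0) (true :: false :: t) (false :: t) :=
    fun s t => ⟨(H.x1_100 s).mul (H.pi0_0 _), (H.x1_0 t).mul (H.pi0_10 t)⟩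
  have h0011 : ∀ s t : List Bool,
      Maps (x1 * c1) (false :: false :: s) (true :: false :: s) ∧
      Maps (x1 * c1) (true :: true :: t) (false :: t) :=
    fun s t => ⟨(H.x1_100 s).mul (H.c1_0 _), (H.x1_0 t).mul (H.c1_11 t)⟩
  have h0110 : ∀ s t : List Bool,
      Maps (x1 * (c1⁻¹ * x0)) (false :: true :: s) (false :: s) ∧
      Maps (x1 * (c1⁻¹ * x0)) (true :: false :: t) (true :: false :: t) :=
    fun s t => ⟨(H.x1_0 s).mul ((H.c1_0 s).inv.mul (H.x0_01 s)),
      (H.x1_100 t).mul ((H.c1_10 _).inv.mul (H.x0_1 _))⟩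
  have h0111 : ∀ s t : List Bool,
      Maps (c1 * (x1⁻¹ * (pi0 * x0))) (false :: true :: s) (true :: false :: s) ∧
      Maps (c1 * (x1⁻¹ * (pi0 * x0))) (true :: true :: t) (false :: t) :=
    fun s t => ⟨(H.c1_0 s).mul ((H.x1_0 s).inv.mul ((H.pi0_10 s).mul (H.x0_01 s))),
      (H.c1_11 t).mul ((H.x1_11 t).inv.mul ((H.pi0_11 _).mul (H.x0_1 _)))⟩
  have h1011 : ∀ s t : List Bool,
      Maps c1⁻¹ (true :: false :: s) (false :: s) ∧
      Maps c1⁻¹ (true :: true :: t) (true :: false :: t) :=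
    fun s t => ⟨(H.c1_0 s).inv, (H.c1_10 t).inv⟩
  have m0 : x0 ∈ genGroup x0 x1 c1 pi0 := x0_mem
  have m1 : x1 ∈ genGroup x0 x1 c1 pi0 := x1_mem
  have mc : c1 ∈ genGroup x0 x1 c1 pi0 := c1_mem
  have mp : pi0 ∈ genGroup x0 x1 c1 pi0 := pi0_mem
  have m2 := mul_mem m1 mp
  have m3 := mul_mem m1 mc
  have m4 := mul_mem m1 (mul_mem (inv_mem mc) m0)
  have m5 := mul_mem mc (mul_mem (inv_mem m1) (mul_mem mp m0))
  have m6 := inv_mem mc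
  cases a <;> cases b <;> cases c <;> cases d
  · simp at h
  · exact ⟨_, m0, .inl (h0001 s t)⟩
  · exact ⟨_, m2, .inr (h0010 s t)⟩
  · exact ⟨_, m3, .inr (h0011 s t)⟩
  · exact ⟨_, m0, .inr (h0001 t s).symm⟩
  · simp at h
  · exact ⟨_, m4, .inl (h0110 s t)⟩
  · exact ⟨_, m5, .inr (h0111 s t)⟩
  · exact ⟨_, m2, .inl (h0010 t s).symm⟩
  · exact ⟨_, m4, .inr (h0110 t s).symm⟩
  · simp at h
  · exact ⟨_, m6, .inl (h1011 s t)⟩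
  · exact ⟨_, m3, .inl (h0011 t s).symm⟩
  · exact ⟨_, m5, .inl (h0111 t s).symm⟩
  · exact ⟨_, m6, .inr (h1011 t s).symm⟩
  · simp at h

lemma hasSwap_zero_one {v : List Bool}
    (ih : ∀ a b : List Bool, a.length + b.length < v.length + 2 → ¬ a <+: b → ¬ b <+: a →
      HasSwap (genGroup x0 x1 c1 pi0) a b) :
    HasSwap (genGroup x0 x1 c1 pi0) [false] (true :: v) := by
  have mc : c1 ∈ genGroup x0 x1 c1 pi0 := c1_mem
  have m1 : x1 ∈ genGroup x0 x1 c1 pi0 := x1_mem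
  have mp : pi0 ∈ genGroup x0 x1 c1 pi0 := pi0_mem
  have base : HasSwap (genGroup x0 x1 c1 pi0) [false] [true, false] :=
    ⟨pi0, mp, isSwap_pi0 H⟩
  match v with
  | [] => exact ⟨c1 * x0, mul_mem mc x0_mem, isSwap_halves H⟩
  | [false] => exact base
  | [true] => exact HasSwap.of_maps mc (H.c1_0 []) (H.c1_11 []) base.symm
  | false :: false :: v =>
    exact HasSwap.of_maps m1 (H.x1_0 []) (H.x1_100 v)
      (ih _ _ (by simp; omega) (by simp) (by simp))
  | false :: true :: v =>
    exact HasSwap.of_maps (mul_mem (inv_mem m1) (mul_mem mp mc))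
      ((H.x1_0 []).inv.mul ((H.pi0_10 []).mul (H.c1_0 [])))
      ((H.x1_11 v).inv.mul ((H.pi0_11 _).mul (H.c1_10 _)))
      (ih _ _ (by simp; omega) (by simp) (by simp))
  | true :: false :: v =>
    exact HasSwap.of_maps (mul_mem m1 (mul_mem mp mc))
      ((H.x1_0 []).mul ((H.pi0_10 []).mul (H.c1_0 [])))
      ((H.x1_100 v).mul ((H.pi0_0 _).mul (H.c1_11 _)))
      (ih _ _ (by simp; omega) (by simp) (by simp))
  | true :: true :: v =>
    exact HasSwap.of_maps (inv_mem m1) (H.x1_0 []).inv (H.x1_11 v).inv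
      (ih _ _ (by simp; omega) (by simp) (by simp))

/-- All swaps of incomparable cylinders lie in the group generated by `x0, x1, c1, pi0`. -/
lemma hasSwap (u v : List Bool) (huv : ¬ u <+: v) (hvu : ¬ v <+: u) :
    HasSwap (genGroup x0 x1 c1 pi0) u v := by
  induction hn : u.length + v.length using Nat.strong_induction_on generalizing u v with
  | _ n ih =>
  have ih' : ∀ a b : List Bool, a.length + b.length < u.length + v.length → ¬ a <+: b →
      ¬ b <+: a → HasSwap (genGroup x0 x1 c1 pi0) a b :=
    fun a b h1 h2 h3 => ih _ (hn ▸ h1) a b h2 h3 rfl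
  have flip : ∀ {w : List Bool},
      Maps (c1 * x0) (true :: w) (false :: w) ∧ Maps (c1 * x0) (false :: w) (true :: w) :=
    fun {w} => ⟨(isSwap_halves H).2.1.append w, (isSwap_halves H).1.append w⟩
  have mf : c1 * x0 ∈ genGroup x0 x1 c1 pi0 := mul_mem c1_mem x0_mem
  match u, v with
  | [], _ => simp at huv
  | _, [] => simp at hvu
  | [false], false :: _ => simp at huv
  | [true], true :: _ => simp at huv
  | false :: _, [false] => simp at hvu
  | true :: _, [true] => simp at hvu
  | [false], true :: w =>
    exact hasSwap_zero_one H fun a b h => ih' a b (by simp at h ⊢; omega)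
  | true :: w, [false] =>
    exact (hasSwap_zero_one H fun a b h => ih' a b (by simp at h ⊢; omega)).symm
  | [true], false :: w =>
    exact HasSwap.of_maps mf flip.1 flip.2
      (hasSwap_zero_one H fun a b h => ih' a b (by simp at h ⊢; omega))
  | false :: w, [true] =>
    exact (HasSwap.of_maps mf flip.1 flip.2
      (hasSwap_zero_one H fun a b h => ih' a b (by simp at h ⊢; omega))).symm
  | a :: b :: s, c :: d :: t =>
    by_cases h : a = c ∧ b = d
    · obtain ⟨rfl, rfl⟩ := h
      obtain ⟨f, hf, h1, h2⟩ := exists_maps_of_two_letters H a b s t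
      refine HasSwap.of_maps hf h1 h2 (ih' _ _ (by simp; omega) ?_ ?_)
      · simpa using huv
      · simpa using hvu
    · obtain ⟨f, hf, ⟨h1, h2⟩ | ⟨h1, h2⟩⟩ := exists_maps_of_ne_two_letters H a b c d s t h <;>
      exact HasSwap.of_maps hf h1 h2 (ih' _ _ (by simp) (by simp) (by simp))

end genGroup

/-- The words `u i`, `i ∈ T`, form a complete prefix code. -/
def IsCode {ι : Type*} (T : Finset ι) (u : ι → List Bool) : Prop :=
  ∀ ω : CSeq, ∃! i, i ∈ T ∧ IsPref (u i) ω

namespace IsCode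

variable {ι : Type*} {T : Finset ι} {u : ι → List Bool}

lemma eq_of_isPref (h : IsCode T u) {i j : ι} (hi : i ∈ T) (hj : j ∈ T) {ω : CSeq}
    (hi' : IsPref (u i) ω) (hj' : IsPref (u j) ω) : i = j :=
  (h ω).unique ⟨hi, hi'⟩ ⟨hj, hj'⟩

lemma eq_of_prefix (h : IsCode T u) {i j : ι} (hi : i ∈ T) (hj : j ∈ T)
    (hij : u i <+: u j) : i = j :=
  h.eq_of_isPref hi hj (ω := app (u j) fun _ => false) (.of_prefix hij (isPref_app _ _))
    (isPref_app _ _)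

lemma card_pos (h : IsCode T u) : 0 < T.card := by
  obtain ⟨i, ⟨hi, -⟩, -⟩ := h fun _ => false
  exact Finset.card_pos.mpr ⟨i, hi⟩

lemma card_eq_one_of_nil (h : IsCode T u) {i : ι} (hi : i ∈ T) (hu : u i = []) :
    T.card = 1 :=
  Finset.card_eq_one.mpr ⟨i, Finset.eq_singleton_iff_unique_mem.mpr
    ⟨hi, fun _ hj => (h.eq_of_prefix hi hj (hu ▸ List.nil_prefix)).symm⟩⟩

lemma nil_of_card_eq_one (h : IsCode T u) (hT : T.card = 1) {i : ι} (hi : i ∈ T) :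
    u i = [] := by
  obtain ⟨k, rfl⟩ := Finset.card_eq_one.mp hT
  obtain rfl := Finset.mem_singleton.mp hi
  by_contra hne
  obtain ⟨b, s, hbs⟩ := List.exists_cons_of_ne_nil hne
  obtain ⟨j, ⟨hj, ζ, hζ⟩, -⟩ := h fun _ => !b
  obtain rfl := Finset.mem_singleton.mp hj
  have := congrFun hζ 0
  rw [hbs, app_apply_lt _ _ (by simp)] at this
  simp at this

lemma exists_sibling_aux (h : IsCode T u) (hT : T.card ≠ 1) :
    ∃ i ∈ T, ∃ j ∈ T, ∃ w b, u i = w ++ [b] ∧ u j = w ++ [!b] := by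
  obtain ⟨i, hi, hmax⟩ := T.exists_max_image (fun i => (u i).length)
    (Finset.card_pos.mp h.card_pos)
  have hne : u i ≠ [] := fun h0 => hT (h.card_eq_one_of_nil hi h0)
  obtain ⟨w, b, hw⟩ : ∃ w b, u i = w ++ [b] :=
    ⟨_, _, (List.dropLast_append_getLast hne).symm⟩
  obtain ⟨j, ⟨hj, hj'⟩, -⟩ := h (app (w ++ [!b]) fun _ => false)
  refine ⟨i, hi, j, hj, w, b, hw, ?_⟩
  have hlen : (u j).length ≤ (w ++ [!b]).length := by
    have := hmax j hj
    rw [hw] at this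
    simpa using this
  have hpre := hj'.prefix_of_length_le (isPref_app _ _) hlen
  rcases List.prefix_concat_iff.mp hpre with h1 | h1
  · exact h1
  · obtain rfl : j = i := h.eq_of_prefix hj hi (by rw [hw]; exact h1.trans (List.prefix_append _ _))
    rw [hw] at h1
    have := h1.length_le
    simp at this

lemma exists_sibling (h : IsCode T u) (hT : T.card ≠ 1) :
    ∃ i ∈ T, ∃ j ∈ T, ∃ w, u i = w ++ [false] ∧ u j = w ++ [true] := by
  obtain ⟨i, hi, j, hj, w, b, h1, h2⟩ := h.exists_sibling_aux hT
  cases b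
  · exact ⟨i, hi, j, hj, w, h1, h2⟩
  · exact ⟨j, hj, i, hi, w, h2, h1⟩

variable [DecidableEq ι]

lemma comp_swap (h : IsCode T u) {i j : ι} (hi : i ∈ T) (hj : j ∈ T) :
    IsCode T (u ∘ Equiv.swap i j) := by
  have hmem : ∀ k, k ∈ T → Equiv.swap i j k ∈ T := by
    intro k hk
    rw [Equiv.swap_apply_def]
    split_ifs <;> assumption
  intro ω
  obtain ⟨k, ⟨hk, hk'⟩, huniq⟩ := h ω
  refine ⟨Equiv.swap i j k, ⟨hmem k hk, by simpa using hk'⟩, fun l ⟨hl, hl'⟩ => ?_⟩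
  rw [← huniq _ ⟨hmem l hl, hl'⟩, Equiv.swap_apply_self]

lemma merge (h : IsCode T u) {i j : ι} (hi : i ∈ T) (hj : j ∈ T) {w : List Bool}
    (hiw : u i = w ++ [false]) (hjw : u j = w ++ [true]) :
    IsCode (T.erase j) (Function.update u i w) := by
  have hij : i ≠ j := by rintro rfl; simp [hiw] at hjw
  have hcase : ∀ ω, IsPref w ω → IsPref (u i) ω ∨ IsPref (u j) ω := by
    rintro ω ⟨ζ, rfl⟩
    obtain ⟨ξ, hξ⟩ := exists_cons ζ
    cases hb : ζ 0 <;> rw [hb] at hξ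
    · exact .inl ⟨ξ, by rw [hiw, app_append, ← hξ]⟩
    · exact .inr ⟨ξ, by rw [hjw, app_append, ← hξ]⟩
  intro ω
  by_cases hw : IsPref w ω
  · refine ⟨i, ⟨by simp [hij, hi], by simpa using hw⟩, fun l ⟨hl, hl'⟩ => ?_⟩
    by_contra hli
    rw [Function.update_of_ne hli] at hl'
    obtain ⟨hlj, hl⟩ := Finset.mem_erase.mp hl
    rcases hcase ω hw with h' | h'
    · exact hli (h.eq_of_isPref hl hi hl' h')
    · exact hlj (h.eq_of_isPref hl hj hl' h')
  · obtain ⟨k, ⟨hk, hk'⟩, huniq⟩ := h ω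
    have hki : k ≠ i := by
      rintro rfl
      exact hw (.of_prefix (hiw ▸ List.prefix_append _ _) hk')
    have hkj : k ≠ j := by
      rintro rfl
      exact hw (.of_prefix (hjw ▸ List.prefix_append _ _) hk')
    refine ⟨k, ⟨by simp [hkj, hk], by rwa [Function.update_of_ne hki]⟩, fun l ⟨hl, hl'⟩ => ?_⟩
    have hli : l ≠ i := by
      rintro rfl
      exact hw (by simpa using hl')
    rw [Function.update_of_ne hli] at hl'
    exact huniq l ⟨Finset.mem_of_mem_erase hl, hl'⟩

end IsCode

lemma Maps.merge {g : VPerm} {u v : List Bool} (h0 : Maps g (u ++ [false]) (v ++ [false]))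
    (h1 : Maps g (u ++ [true]) (v ++ [true])) : Maps g u v := by
  intro ω
  obtain ⟨ξ, hξ⟩ := exists_cons ω
  cases hb : ω 0 <;> rw [hb] at hξ
  · rw [hξ, ← app_append, ← app_append, h0]
  · rw [hξ, ← app_append, ← app_append, h1]

section

variable {x0 x1 c1 pi0 : VPerm} (H : IsGens x0 x1 c1 pi0)
include H

lemma exists_mul_maps_comp_swap {ι : Type*} [DecidableEq ι] {T : Finset ι}
    {u v : ι → List Bool} {g : VPerm} (hv : IsCode T v)
    (hg : ∀ i ∈ T, Maps g (u i) (v i)) {i j : ι} (hi : i ∈ T) (hj : j ∈ T) :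
    ∃ s ∈ genGroup x0 x1 c1 pi0, ∀ k ∈ T, Maps (s * g) (u k) ((v ∘ Equiv.swap i j) k) := by
  by_cases hij : i = j
  · subst hij
    exact ⟨1, one_mem _, by simpa using hg⟩
  · obtain ⟨s, hs, h1, h2, h3⟩ := hasSwap H (v i) (v j)
      (fun h => hij (hv.eq_of_prefix hi hj h)) (fun h => hij (hv.eq_of_prefix hj hi h).symm)
    refine ⟨s, hs, fun k hk => Maps.mul (v := v k) ?_ (hg k hk)⟩
    by_cases hki : k = i
    · subst hki; simpa using h1
    by_cases hkj : k = j
    · subst hkj; simpa using h2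
    rw [Function.comp_apply, Equiv.swap_apply_of_ne_of_ne hki hkj]
    exact fun ω => h3 _ (fun h => hki (hv.eq_of_isPref hk hi (isPref_app _ _) h))
      (fun h => hkj (hv.eq_of_isPref hk hj (isPref_app _ _) h))

lemma mem_genGroup_of_maps {ι : Type*} [DecidableEq ι] (n : ℕ) :
    ∀ (T : Finset ι) (u v : ι → List Bool) (g : VPerm), T.card = n + 1 → IsCode T u →
      IsCode T v → (∀ i ∈ T, Maps g (u i) (v i)) → g ∈ genGroup x0 x1 c1 pi0 := by
  induction n with
  | zero =>
    intro T u v g hT hu hv hg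
    obtain ⟨i, rfl⟩ := Finset.card_eq_one.mp hT
    have := hg i (by simp)
    rw [hu.nil_of_card_eq_one hT (by simp), hv.nil_of_card_eq_one hT (by simp)] at this
    have h1 : g = 1 := by
      ext1 ω
      simpa [app_nil] using this ω
    rw [h1]
    exact one_mem _
  | succ n ih =>
    intro T u v g hT hu hv hg
    obtain ⟨i, hi, j, hj, w, hiw, hjw⟩ := hu.exists_sibling (by omega)
    obtain ⟨k, hk, l, hl, z, hkz, hlz⟩ := hv.exists_sibling (by omega)
    have hij : i ≠ j := by rintro rfl; simp [hiw] at hjw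
    have hkl : k ≠ l := by rintro rfl; simp [hkz] at hlz
    obtain ⟨s, hs, hsg⟩ := exists_mul_maps_comp_swap H hv hg hi hk
    have hv1 := hv.comp_swap hi hk
    set v1 := v ∘ Equiv.swap i k with hv1def
    have hmem : Equiv.swap i k l ∈ T := by
      rw [Equiv.swap_apply_def]
      split_ifs <;> assumption
    have hne : i ≠ Equiv.swap i k l := by
      intro h
      exact hkl ((Equiv.swap i k).injective ((Equiv.swap_apply_right i k).trans h))
    obtain ⟨t, ht, htg⟩ := exists_mul_maps_comp_swap H hv1 hsg hj hmem
    have hv2 := hv1.comp_swap hj hmem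
    set v2 := v1 ∘ Equiv.swap j (Equiv.swap i k l) with hv2def
    have hi2 : v2 i = z ++ [false] := by
      rw [hv2def, Function.comp_apply, Equiv.swap_apply_of_ne_of_ne hij hne, hv1def,
        Function.comp_apply, Equiv.swap_apply_left, hkz]
    have hj2 : v2 j = z ++ [true] := by
      rw [hv2def, Function.comp_apply, Equiv.swap_apply_left, hv1def,
        Function.comp_apply, Equiv.swap_apply_self, hlz]
    have key : t * (s * g) ∈ genGroup x0 x1 c1 pi0 := by
      refine ih (T.erase j) (Function.update u i w) (Function.update v2 i z) _
        (by rw [Finset.card_erase_of_mem hj, hT]; rfl) (hu.merge hi hj hiw hjw)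
        (hv2.merge hi hj hi2 hj2) fun m hm => ?_
      by_cases hmi : m = i
      · subst hmi
        rw [Function.update_self, Function.update_self]
        refine Maps.merge ?_ ?_
        · rw [← hiw, ← hi2]; exact htg _ hi
        · rw [← hjw, ← hj2]; exact htg _ hj
      · rw [Function.update_of_ne hmi, Function.update_of_ne hmi]
        exact htg m (Finset.mem_of_mem_erase hm)
    rwa [Subgroup.mul_mem_cancel_left _ ht, Subgroup.mul_mem_cancel_left _ hs] at key

/-- Thompson's group `V` is generated by `x0, x1, c1, pi0`. -/
lemma mem_genGroup {g : VPerm} (hg : InV g) : g ∈ genGroup x0 x1 c1 pi0 := by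
  obtain ⟨T, h1, h2, h3⟩ := hg
  have hc : IsCode T Prod.fst := h1
  have := hc.card_pos
  exact mem_genGroup_of_maps H (T.card - 1) T Prod.fst Prod.snd g (by omega) h1 h2 h3

end

/-- The first `a` letters of `ω` followed by `ζ`. -/
def splice (ω : CSeq) (a : ℕ) (ζ : CSeq) : CSeq := fun n => if n < a then ω n else ζ (n - a)

lemma splice_shift (ω : CSeq) (a : ℕ) : splice ω a (fun n => ω (a + n)) = ω := by
  funext n
  simp only [splice]
  split_ifs with h
  · rfl
  · congr 1; omega

lemma splice_add (ω : CSeq) (a k : ℕ) (ζ : CSeq) :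
    splice ω (a + k) ζ = splice ω a (splice (fun n => ω (a + n)) k ζ) := by
  funext n
  simp only [splice]
  by_cases h1 : n < a
  · simp [h1, Nat.lt_add_right]
  · by_cases h2 : n < a + k
    · have h3 : n - a < k := by omega
      simp only [h1, h2, h3, if_true, if_false]
      congr 1; omega
    · have h3 : ¬ n - a < k := by omega
      simp [h1, h2, h3, Nat.sub_sub]

lemma splice_app (u : List Bool) (ω ζ : CSeq) : splice (app u ω) u.length ζ = app u ζ := by
  funext n
  simp only [splice, app]
  split_ifs <;> rfl

/-- Near `ω`, the permutation `g` replaces the first `a` letters by `b` letters. -/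
def Germ (g : VPerm) (ω : CSeq) (a b : ℕ) : Prop :=
  ∀ ζ, g (splice ω a ζ) = splice (g ω) b ζ

lemma Maps.germ {g : VPerm} {u v : List Bool} (h : Maps g u v) (ω : CSeq) :
    Germ g (app u ω) u.length v.length := by
  intro ζ
  rw [splice_app, h, h, splice_app]

lemma Germ.inv {g : VPerm} {ω : CSeq} {a b : ℕ} (h : Germ g ω a b) : Germ g⁻¹ (g ω) b a := by
  intro ζ
  rw [Equiv.Perm.inv_eq_iff_eq, ← h]
  simp

lemma Germ.add {g : VPerm} {ω : CSeq} {a b : ℕ} (h : Germ g ω a b) (k : ℕ) :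
    Germ g ω (a + k) (b + k) := by
  intro ζ
  have hs : (fun n => g ω (b + n)) = fun n => ω (a + n) := by
    have := h fun n => ω (a + n)
    rw [splice_shift] at this
    funext n
    rw [this]
    simp [splice]
  rw [splice_add, splice_add, h, hs]

lemma Germ.mul {g h : VPerm} {ω : CSeq} {a b c : ℕ} (hh : Germ h (g ω) b c)
    (hg : Germ g ω a b) : Germ (h * g) ω a c := by
  intro ζ
  rw [Equiv.Perm.mul_apply, hg, hh, Equiv.Perm.mul_apply]

lemma splice_not_lt {ω : CSeq} {b b' : ℕ} (h : ∀ ζ, splice ω b ζ = splice ω b' ζ) :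
    ¬ b < b' := by
  intro hlt
  have := congrFun (h fun _ => !ω b) b
  simp [splice, hlt] at this

lemma Germ.unique {g : VPerm} {ω : CSeq} {a b b' : ℕ} (h : Germ g ω a b)
    (h' : Germ g ω a b') : b = b' := by
  have key : ∀ ζ, splice (g ω) b ζ = splice (g ω) b' ζ := fun ζ => (h ζ).symm.trans (h' ζ)
  have h1 := splice_not_lt key
  have h2 := splice_not_lt fun ζ => (key ζ).symm
  omega

/-- Minus the binary logarithm of the derivative of `g` at `ω` is `d`. -/
def LogDeriv (g : VPerm) (ω : CSeq) (d : ℤ) : Prop :=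
  ∃ a b : ℕ, Germ g ω a b ∧ d = (b : ℤ) - a

lemma Maps.logDeriv {g : VPerm} {u v : List Bool} (h : Maps g u v) (ω : CSeq) :
    LogDeriv g (app u ω) ((v.length : ℤ) - u.length) :=
  ⟨_, _, h.germ ω, rfl⟩

lemma Germ.exists_mul {g h : VPerm} {ω : CSeq} {a b c d : ℕ} (hg : Germ g ω a b)
    (hh : Germ h (g ω) c d) :
    ∃ k, k ≤ c ∧ ∃ e, Germ (h * g) ω (a + k) e ∧ (e : ℤ) - (a + k : ℕ) = (d - c) + (b - a) := by
  rcases le_total c b with hcb | hcb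
  · refine ⟨0, by omega, d + (b - c), Germ.mul (b := b) ?_ hg, by push_cast [hcb]; ring⟩
    convert hh.add (b - c) using 1; omega
  · refine ⟨c - b, by omega, d, Germ.mul hh ?_, by push_cast [hcb]; ring⟩
    convert hg.add (c - b) using 1; omega

namespace LogDeriv

variable {g h : VPerm} {ω : CSeq} {d e : ℤ}

lemma mul (hh : LogDeriv h (g ω) e) (hg : LogDeriv g ω d) :
    LogDeriv (h * g) ω (e + d) := by
  obtain ⟨a, b, hg, rfl⟩ := hg
  obtain ⟨a', b', hh, rfl⟩ := hh
  obtain ⟨k, -, f, hf, hd⟩ := hg.exists_mul hh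
  exact ⟨_, _, hf, hd.symm⟩

lemma inv (hg : LogDeriv g ω d) : LogDeriv g⁻¹ (g ω) (-d) := by
  obtain ⟨a, b, hg, rfl⟩ := hg
  exact ⟨_, _, hg.inv, by ring⟩

lemma inv_of_eq {ω' : CSeq} (hg : LogDeriv g ω d) (h : g ω = ω') : LogDeriv g⁻¹ ω' (-d) :=
  h ▸ hg.inv

lemma unique (h : LogDeriv g ω d) (h' : LogDeriv g ω e) : d = e := by
  obtain ⟨a, b, h, rfl⟩ := h
  obtain ⟨a', b', h', rfl⟩ := h'
  have h1 := h.add a'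
  have h2 := h'.add a
  rw [add_comm a'] at h2
  have := h1.unique h2
  omega

lemma pow (hg : LogDeriv g ω d) (hω : g ω = ω) (m : ℕ) :
    LogDeriv (g ^ m) ω (m * d) ∧ (g ^ m) ω = ω := by
  induction m with
  | zero => exact ⟨⟨0, 0, fun ζ => rfl, by simp⟩, rfl⟩
  | succ m ih =>
    rw [pow_succ']
    refine ⟨?_, by rw [Equiv.Perm.mul_apply, ih.2, hω]⟩
    convert mul (g := g ^ m) (by rw [ih.2]; exact hg) ih.1 using 1
    push_cast; ring

end LogDeriv

/-- `x` or its inverse lies in `S`. -/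
def IsLetter (S : Set VPerm) (x : VPerm) : Prop := x ∈ S ∨ x⁻¹ ∈ S

lemma IsLetter.inv {S : Set VPerm} {x : VPerm} (h : IsLetter S x) : IsLetter S x⁻¹ := by
  rcases h with h | h
  · exact .inr (by simpa using h)
  · exact .inl h

lemma IsLetter.mem {S : Set VPerm} {x : VPerm} (h : IsLetter S x) :
    x ∈ Subgroup.closure S := by
  rcases h with h | h
  · exact Subgroup.subset_closure h
  · simpa using inv_mem (Subgroup.subset_closure h)

/-- `g` is a product of `n` letters. -/
def IsWord (S : Set VPerm) (n : ℕ) (g : VPerm) : Prop :=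
  ∃ l : List VPerm, l.length = n ∧ (∀ x ∈ l, IsLetter S x) ∧ l.prod = g

namespace IsWord

variable {S : Set VPerm} {m n : ℕ} {g h x : VPerm}

lemma one : IsWord S 0 1 := ⟨[], by simp⟩

lemma mul (hg : IsWord S m g) (hh : IsWord S n h) : IsWord S (m + n) (g * h) := by
  obtain ⟨l, rfl, hl, rfl⟩ := hg
  obtain ⟨l', rfl, hl', rfl⟩ := hh
  exact ⟨l ++ l', by simp, by simpa [or_imp, forall_and] using ⟨hl, hl'⟩, by simp⟩

lemma _root_.IsLetter.isWord (hx : IsLetter S x) : IsWord S 1 x := ⟨[x], by simpa using hx⟩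

lemma inv (hg : IsWord S n g) : IsWord S n g⁻¹ := by
  obtain ⟨l, rfl, hl, rfl⟩ := hg
  refine ⟨(l.map fun x => x⁻¹).reverse, by simp, fun x hx => ?_, (List.prod_inv_reverse l).symm⟩
  simp only [List.mem_reverse, List.mem_map] at hx
  obtain ⟨y, hy, rfl⟩ := hx
  exact (hl y hy).inv

lemma pow (hx : IsLetter S x) (m : ℕ) : IsWord S m (x ^ m) :=
  ⟨List.replicate m x, by simp, fun y hy => (List.eq_of_mem_replicate hy) ▸ hx, by simp⟩

lemma mem (hg : IsWord S n g) : g ∈ Subgroup.closure S := by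
  obtain ⟨l, -, hl, rfl⟩ := hg
  exact Subgroup.list_prod_mem _ fun x hx => (hl x hx).mem

lemma wlen_le (hg : IsWord S n g) : wlen S g ≤ n := Nat.sInf_le hg

lemma wlen (hg : g ∈ Subgroup.closure S) : IsWord S (wlen S g) g := by
  refine Nat.sInf_mem (s := {n | IsWord S n g}) ?_
  induction hg using Subgroup.closure_induction with
  | mem x hx => exact ⟨1, IsLetter.isWord (.inl hx)⟩
  | one => exact ⟨0, one⟩
  | mul x y _ _ hx hy =>
    obtain ⟨⟨m, hx⟩, n, hy⟩ := hx, hy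
    exact ⟨_, hx.mul hy⟩
  | inv x _ hx =>
    obtain ⟨m, hx⟩ := hx
    exact ⟨_, hx.inv⟩

end IsWord

lemma wlen_le_wlen_mul {S : Set VPerm} {g x : VPerm} {n : ℕ} (hg : g ∈ Subgroup.closure S)
    (hx : IsWord S n x) : wlen S g ≤ n + wlen S (x * g) := by
  have := (hx.inv.mul (IsWord.wlen (mul_mem hx.mem hg))).wlen_le
  rwa [inv_mul_cancel_left] at this

/-- Every letter changes at most three letters of a sequence, and distorts by a factor of at
most two. -/
def BoundedLetters (S : Set VPerm) : Prop :=
  ∀ x, IsLetter S x → ∀ ω, ∃ a b : ℕ, a ≤ 3 ∧ |(b : ℤ) - a| ≤ 1 ∧ Germ x ω a b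

lemma boundedLetters_of {S : Set VPerm} (h : ∀ x ∈ S, ∃ T, Represents x T ∧
    ∀ p ∈ T, p.1.length ≤ 3 ∧ p.2.length ≤ 3 ∧ |(p.2.length : ℤ) - p.1.length| ≤ 1) :
    BoundedLetters S := by
  have key : ∀ x ∈ S, ∀ ω, ∃ a b : ℕ, a ≤ 3 ∧ b ≤ 3 ∧ |(b : ℤ) - a| ≤ 1 ∧ Germ x ω a b := by
    intro x hx ω
    obtain ⟨T, hT, hb⟩ := h x hx
    obtain ⟨p, ⟨hp, ζ, rfl⟩, -⟩ := hT.1 ω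
    have hm : Maps x p.1 p.2 := hT.2.2 p hp
    exact ⟨_, _, (hb p hp).1, (hb p hp).2.1, (hb p hp).2.2, hm.germ ζ⟩
  rintro x (hx | hx) ω
  · obtain ⟨a, b, h1, -, h2⟩ := key x hx ω
    exact ⟨a, b, h1, h2⟩
  · obtain ⟨a, b, -, h2, h3, h4⟩ := key _ hx (x ω)
    refine ⟨b, a, h2, by rwa [abs_sub_comm], ?_⟩
    have := h4.inv
    simpa using this

lemma IsWord.germ {S : Set VPerm} (hS : BoundedLetters S) {n : ℕ} {g : VPerm}
    (hg : IsWord S n g) (ω : CSeq) :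
    ∃ a b : ℕ, a ≤ 3 * n ∧ |(b : ℤ) - a| ≤ n ∧ Germ g ω a b := by
  obtain ⟨l, rfl, hl, rfl⟩ := hg
  induction l with
  | nil => exact ⟨0, 0, by simp, by simp, fun ζ => rfl⟩
  | cons x l ih =>
    obtain ⟨a, b, h1, h2, h3⟩ := ih fun y hy => hl y (by simp [hy])
    obtain ⟨c, d, h4, h5, h6⟩ := hS x (hl x (by simp)) (l.prod ω)
    obtain ⟨k, hk, e, he, heq⟩ := h3.exists_mul h6
    refine ⟨a + k, e, by simp only [List.length_cons]; omega, ?_, by simpa using he⟩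
    rw [heq]
    refine (abs_add_le _ _).trans ?_
    push_cast [List.length_cons]
    linarith

lemma IsWord.logDeriv {S : Set VPerm} (hS : BoundedLetters S) {n : ℕ} {g : VPerm}
    (hg : IsWord S n g) (ω : CSeq) : ∃ d : ℤ, |d| ≤ n ∧ LogDeriv g ω d := by
  obtain ⟨a, b, -, h, h'⟩ := hg.germ hS ω
  exact ⟨_, h, a, b, h', rfl⟩

lemma LogDeriv.abs_le_wlen {S : Set VPerm} (hS : BoundedLetters S) {g : VPerm} {ω : CSeq}
    {d : ℤ} (h : LogDeriv g ω d) (hg : g ∈ Subgroup.closure S) : |d| ≤ wlen S g := by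
  obtain ⟨e, he, he'⟩ := (IsWord.wlen hg).logDeriv hS ω
  rwa [h.unique he']

/-- Multiplying `g` by `n` letters, one after the other, leads to `h` through elements of
length at least `B`. -/
inductive Conn (S : Set VPerm) (B : ℕ) (g : VPerm) : ℕ → VPerm → Prop
  | refl : B ≤ wlen S g → Conn S B g 0 g
  | step {n : ℕ} {h x : VPerm} : Conn S B g n h → IsLetter S x → B ≤ wlen S (x * h) →
      Conn S B g (n + 1) (x * h)

namespace Conn

variable {S : Set VPerm} {B m n : ℕ} {g h k : VPerm}

lemma le_wlen (c : Conn S B g n h) : B ≤ wlen S h := by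
  cases c <;> assumption

lemma trans (c : Conn S B g m h) (c' : Conn S B h n k) : Conn S B g (m + n) k := by
  induction c' with
  | refl => exact c
  | step _ hx hB ih => exact .step ih hx hB

lemma symm (c : Conn S B g n h) : Conn S B h n g := by
  induction c with
  | refl hB => exact .refl hB
  | @step n h x c hx hB ih =>
    have h1 : Conn S B (x * h) 1 (x⁻¹ * (x * h)) :=
      .step (.refl hB) hx.inv (by rw [inv_mul_cancel_left]; exact c.le_wlen)
    rw [inv_mul_cancel_left] at h1
    rw [add_comm]
    exact h1.trans ih

lemma exists_wordEval (c : Conn S B g n h) :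
    ∃ w : List VPerm, (∀ x ∈ w, IsLetter S x) ∧ w.length = n ∧ wordEval g w = h ∧
      ∀ w', w' <+: w → B ≤ wlen S (wordEval g w') := by
  induction c with
  | refl hB =>
    refine ⟨[], by simp, rfl, rfl, fun w' hw' => ?_⟩
    rw [List.prefix_nil.mp hw']
    exact hB
  | @step n h x c hx hB ih =>
    obtain ⟨w, h1, h2, h3, h4⟩ := ih
    have h5 : wordEval g (w ++ [x]) = x * h := by
      simp only [wordEval, List.foldl_append] at h3 ⊢
      rw [h3]
      rfl
    refine ⟨w ++ [x], ?_, by simp [h2], h5, fun w' hw' => ?_⟩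
    · intro y hy
      rcases List.mem_append.mp hy with hy | hy
      · exact h1 y hy
      · rw [List.mem_singleton.mp hy]; exact hx
    · rcases List.prefix_concat_iff.mp hw' with rfl | hw'
      · rwa [h5]
      · exact h4 w' hw'

variable (hS : BoundedLetters S) {ω : CSeq} {d : ℤ} {x σ : VPerm} {ℓ : ℕ}
include hS

lemma of_isWord (hσ : IsWord S ℓ σ) (hh : h ∈ Subgroup.closure S) (hd : LogDeriv h ω d)
    (hB : (B : ℤ) + ℓ ≤ |d|) : Conn S B h ℓ (σ * h) := by
  obtain ⟨l, rfl, hl, rfl⟩ := hσ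
  have hprod : ∀ l : List VPerm, (∀ x ∈ l, IsLetter S x) → (B : ℤ) + l.length ≤ |d| →
      B ≤ wlen S (l.prod * h) := by
    intro l hl hB
    have hw : IsWord S l.length l.prod := ⟨l, rfl, hl, rfl⟩
    obtain ⟨e, he, he'⟩ := hw.logDeriv hS (h ω)
    have h1 := (he'.mul hd).abs_le_wlen hS (mul_mem hw.mem hh)
    have h2 := abs_sub_abs_le_abs_add d e
    rw [add_comm d e] at h2
    omega
  induction l with
  | nil => exact .refl (by simpa using hprod [] (by simp) hB)
  | cons x l ih =>
    have h1 : ∀ y ∈ l, IsLetter S y := fun y hy => hl y (by simp [hy])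
    have h2 : (B : ℤ) + l.length ≤ |d| := by
      simp only [List.length_cons] at hB
      omega
    have h3 := hprod (x :: l) hl hB
    rw [List.prod_cons, mul_assoc] at h3 ⊢
    exact .step (ih h2 h1) (hl x (by simp)) h3

lemma of_pow (hx : IsLetter S x) (hh : h ∈ Subgroup.closure S) (hd : LogDeriv h ω d)
    (hB : (B : ℤ) ≤ |d|) (hfix : x (h ω) = h ω) (hx0 : LogDeriv x (h ω) 0) (m : ℕ) :
    Conn S B h m (x ^ m * h) := by
  have key : ∀ m : ℕ, B ≤ wlen S (x ^ m * h) := by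
    intro m
    have h1 := (hx0.pow hfix m).1.mul hd
    have := h1.abs_le_wlen hS (mul_mem (pow_mem hx.mem m) hh)
    simp only [mul_zero, zero_add] at this
    omega
  induction m with
  | zero => simpa using Conn.refl (by simpa using key 0)
  | succ m ih =>
    have := key (m + 1)
    rw [pow_succ', mul_assoc] at this ⊢
    exact .step ih hx this

lemma of_conj (hσ : IsWord S ℓ σ) (hx : IsLetter S x) (hh : h ∈ Subgroup.closure S)
    (hd : LogDeriv h ω d) (hB : (B : ℤ) + 2 * ℓ ≤ |d|)
    (hfix : x (σ⁻¹ (h ω)) = σ⁻¹ (h ω)) (hx0 : LogDeriv x (σ⁻¹ (h ω)) 0) (m : ℕ) :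
    Conn S B h (ℓ + m + ℓ) (σ * x ^ m * σ⁻¹ * h) := by
  obtain ⟨e, he, he'⟩ := hσ.inv.logDeriv hS (h ω)
  have h0 := abs_sub_abs_le_abs_add d e
  rw [add_comm d e] at h0
  have hh1 : σ⁻¹ * h ∈ Subgroup.closure S := mul_mem hσ.inv.mem hh
  have hd1 := he'.mul hd
  have hfix1 : x ((σ⁻¹ * h) ω) = (σ⁻¹ * h) ω := hfix
  have hx1 : LogDeriv x ((σ⁻¹ * h) ω) 0 := hx0
  have hd2 := (hx1.pow hfix1 m).1.mul hd1
  have c1 := of_isWord (B := B) hS hσ.inv hh hd (by omega)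
  have c2 := of_pow (B := B) hS hx hh1 hd1 (by omega) hfix1 hx1 m
  have c3 := of_isWord (B := B) hS hσ (mul_mem (pow_mem hx.mem m) hh1) hd2
    (by rw [mul_zero, zero_add]; omega)
  have := (c1.trans c2).trans c3
  rwa [← mul_assoc, ← mul_assoc] at this

lemma of_pow_of_le (hx : IsLetter S x) (hh : h ∈ Subgroup.closure S) {e : ℤ}
    (hd : LogDeriv h ω d) (hfix : x (h ω) = h ω) (hxe : LogDeriv x (h ω) e)
    (hde : ∀ k : ℕ, (k : ℤ) ≤ |k * e + d|) (hB : 2 * B ≤ wlen S h + 1) (m : ℕ) :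
    Conn S B h m (x ^ m * h) := by
  have key : ∀ m : ℕ, B ≤ wlen S (x ^ m * h) := by
    intro m
    have h1 := (hxe.pow hfix m).1.mul hd
    have h2 := h1.abs_le_wlen hS (mul_mem (pow_mem hx.mem m) hh)
    have h3 := wlen_le_wlen_mul hh (IsWord.pow hx m)
    have h4 := hde m
    omega
  induction m with
  | zero => simpa using Conn.refl (by simpa using key 0)
  | succ m ih =>
    have := key (m + 1)
    rw [pow_succ', mul_assoc] at this ⊢
    exact .step ih hx this

end Conn

lemma LogDeriv.conj {x τ : VPerm} {p : CSeq} {d f : ℤ} (hx : LogDeriv x p d) (hp : x p = p)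
    (hτ : LogDeriv τ p f) (m : ℕ) :
    LogDeriv (τ * x ^ m * τ⁻¹) (τ p) (m * d) ∧ (τ * x ^ m * τ⁻¹) (τ p) = τ p := by
  obtain ⟨h1, h2⟩ := hx.pow hp m
  have h3 : τ⁻¹ (τ p) = p := by simp
  constructor
  · have h4 : LogDeriv (τ * x ^ m) p (f + m * d) := LogDeriv.mul (by rwa [h2]) h1
    convert LogDeriv.mul (h := τ * x ^ m) (by rwa [h3]) hτ.inv using 1
    ring
  · simp only [Equiv.Perm.mul_apply]
    rw [h3, h2]

lemma Maps.inv_apply_zero {σ : VPerm} {v : List Bool} (hσ : Maps σ [true] v) {ξ : CSeq}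
    (h : ¬ IsPref v ξ) : (σ⁻¹ ξ) 0 = false := by
  obtain ⟨ζ, hζ⟩ := exists_cons (σ⁻¹ ξ)
  cases hb : (σ⁻¹ ξ) 0
  · rfl
  · rw [hb, Equiv.Perm.inv_eq_iff_eq, hσ] at hζ
    exact (h ⟨ζ, hζ⟩).elim

section

variable {x0 x1 c1 pi0 : VPerm} (H : IsGens x0 x1 c1 pi0)
include H

lemma boundedLetters : BoundedLetters {x0, x1, c1, pi0} := by
  refine boundedLetters_of ?_
  simp only [Set.mem_insert_iff, Set.mem_singleton_iff, forall_eq_or_imp, forall_eq]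
  refine ⟨⟨_, H.x0, ?_⟩, ⟨_, H.x1, ?_⟩, ⟨_, H.c1, ?_⟩, ⟨_, H.pi0, ?_⟩⟩
  · simp [x0T]
  · simp [x1T]
  · simp [c1T]
  · simp [pi0T]

lemma x1_of_zero {ω : CSeq} (h : ω 0 = false) : x1 ω = ω ∧ LogDeriv x1 ω 0 := by
  obtain ⟨ζ, hζ⟩ := exists_cons ω
  rw [h] at hζ
  rw [hζ]
  exact ⟨H.x1_0 [] ζ, by simpa using (H.x1_0 []).logDeriv ζ⟩

lemma x0_zero : x0 (fun _ => false) = (fun _ => false) ∧ LogDeriv x0 (fun _ => false) (-1) := by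
  have h : ∀ s : List Bool, (∀ b ∈ s, b = false) → app s (fun _ => false) = fun _ => false := by
    intro s hs
    funext n
    simp only [app]
    split_ifs with h
    · exact hs _ (List.getElem_mem h)
    · rfl
  constructor
  · have := H.x0_00 [] fun _ => false
    rwa [h _ (by simp), h _ (by simp)] at this
  · have := (H.x0_00 []).logDeriv fun _ => false
    rw [h _ (by simp)] at this
    simpa using this

lemma x1_one : x1 (app [true] fun _ => false) = app [true] (fun _ => false) ∧
    LogDeriv x1 (app [true] fun _ => false) (-1) := by
  have h : ∀ s : List Bool, (∀ b ∈ s, b = false) →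
      app (true :: s) (fun _ => false) = app [true] fun _ => false := by
    intro s hs
    rw [← List.singleton_append, app_append]
    congr 1
    funext n
    simp only [app]
    split_ifs with h
    · exact hs _ (List.getElem_mem h)
    · rfl
  constructor
  · have := H.x1_100 [] fun _ => false
    rwa [h [false, false] (by simp), h [false] (by simp)] at this
  · have := (H.x1_100 []).logDeriv fun _ => false
    rw [h [false, false] (by simp)] at this
    simpa using this

lemma maps_x1_pow (j : ℕ) :
    Maps (x1 ^ j) [true, true, false] (true :: true :: (List.replicate j true ++ [false])) := by
  induction j with
  | zero => exact fun ω => rfl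
  | succ j ih =>
    rw [pow_succ', List.replicate_succ]
    exact (H.x1_11 _).mul ih

/-- An element can be moved, within linear distance and without coming close to the
identity, to an element of extreme derivative at the preimage of `000…`. -/
lemma exists_conn_logDeriv {g : VPerm} (hg : g ∈ Subgroup.closure {x0, x1, c1, pi0})
    {B : ℕ} (hB : 2 * B ≤ wlen {x0, x1, c1, pi0} g + 1) (K : ℕ) :
    ∃ h ω d, Conn {x0, x1, c1, pi0} B g K h ∧
      IsWord {x0, x1, c1, pi0} (wlen {x0, x1, c1, pi0} g + K) h ∧
      h ω = (fun _ => false) ∧ LogDeriv h ω d ∧ (K : ℤ) ≤ |d| := by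
  have hS := boundedLetters H
  obtain ⟨hfix, hd0⟩ := x0_zero H
  have hω : g (g⁻¹ fun _ => false) = fun _ => false := by simp
  obtain ⟨d, -, hd⟩ := (IsWord.wlen hg).logDeriv hS (g⁻¹ fun _ => false)
  obtain ⟨x, e, hx, hxfix, hxe, hde⟩ : ∃ x e, IsLetter {x0, x1, c1, pi0} x ∧
      x (fun _ => false) = (fun _ => false) ∧ LogDeriv x (fun _ => false) e ∧
      ∀ k : ℕ, (k : ℤ) ≤ |k * e + d| := by
    have hx0 : IsLetter {x0, x1, c1, pi0} x0 := .inl (by simp)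
    rcases le_total d 0 with h | h
    · refine ⟨x0, -1, hx0, hfix, hd0, fun k => ?_⟩
      rw [abs_of_nonpos (by omega)]
      omega
    · refine ⟨x0⁻¹, 1, hx0.inv, by rw [Equiv.Perm.inv_eq_iff_eq, hfix],
        by simpa using hd0.inv_of_eq hfix, fun k => ?_⟩
      rw [abs_of_nonneg (by omega)]
      omega
  refine ⟨x ^ K * g, g⁻¹ fun _ => false, K * e + d,
    Conn.of_pow_of_le hS hx hg hd (by rw [hω, hxfix]) (by rwa [hω]) hde hB K, ?_, ?_, ?_, hde K⟩
  · rw [add_comm]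
    exact (IsWord.pow hx K).mul (IsWord.wlen hg)
  · rw [Equiv.Perm.mul_apply, hω]
    exact (hxe.pow hxfix K).2
  · exact LogDeriv.mul (by rw [hω]; exact (hxe.pow hxfix K).1) hd

end

section

variable {x0 x1 c1 pi0 : VPerm} (H : IsGens x0 x1 c1 pi0)
include H

/-- For large `j` and any `y` of length at most `L`, the conjugates of `x1` by `y * τ` and `σ`
have disjoint supports, where `τ` maps the cylinder of `1` to that of `1^(j+2)0`, for a suitable
choice of `σ` among two elements. -/
lemma exists_disjoint {τ y : VPerm} {L j : ℕ}
    (hτ : Maps τ [true] (true :: true :: (List.replicate j true ++ [false])))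
    (hy : IsWord {x0, x1, c1, pi0} L y) (hj : 4 * L ≤ j) :
    ∃ σ c, IsWord {x0, x1, c1, pi0} 3 σ ∧ Maps σ [true] [true, c] ∧
      ∀ ζ, ¬ IsPref [true, c] (y (τ (app [true] ζ))) := by
  set S : Set VPerm := {x0, x1, c1, pi0} with hSdef
  have w0 : IsWord S 1 x0 := IsLetter.isWord (.inl (by simp [hSdef]))
  have wc : IsWord S 1 c1 := IsLetter.isWord (.inl (by simp [hSdef]))
  have wp : IsWord S 1 pi0 := IsLetter.isWord (.inl (by simp [hSdef]))
  set V := true :: true :: (List.replicate j true ++ [false]) with hV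
  have hVlen : V.length = j + 3 := by simp [hV]
  set p := app V fun _ => false with hp
  obtain ⟨a, b, ha, hab, hg⟩ := hy.germ (boundedLetters H) p
  rw [abs_le] at hab
  have hg' := hg.add (j + 3 - a)
  rw [show a + (j + 3 - a) = V.length by omega] at hg'
  have hb : 1 < b + (j + 3 - a) := by omega
  have key : ∀ ζ, y (τ (app [true] ζ)) 1 = y p 1 := by
    intro ζ
    have := hg' ζ
    rw [hp, splice_app, ← hp] at this
    rw [hτ, this]
    simp [splice, hb]
  have hno : ∀ ζ, ¬ IsPref [true, !(y p 1)] (y (τ (app [true] ζ))) := by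
    rintro ζ ⟨ξ, hξ⟩
    have h1 := key ζ
    rw [hξ, app_apply_lt _ _ (by simp)] at h1
    simp at h1
  cases hc : y p 1
  · exact ⟨pi0 * (pi0 * x0), true, wp.mul (wp.mul w0),
      (H.pi0_11 []).mul ((H.pi0_11 []).mul (H.x0_1 [])), by simpa [hc] using hno⟩
  · exact ⟨c1 * (c1 * x0), false, wc.mul (wc.mul w0),
      (H.c1_0 []).mul ((H.c1_11 []).mul (H.x0_1 [])), by simpa [hc] using hno⟩

lemma disjoint_conj_x1 {σ ρ : VPerm} {v : List Bool} (hσ : Maps σ [true] v)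
    (hρ : ∀ ζ, ¬ IsPref v (ρ (app [true] ζ))) (m : ℕ) :
    Commute (σ * x1 ^ m * σ⁻¹) (ρ * x1 ^ m * ρ⁻¹) := by
  have hfix : ∀ {κ : VPerm} {ξ : CSeq}, (κ⁻¹ ξ) 0 = false → (κ * x1 ^ m * κ⁻¹) ξ = ξ := by
    intro κ ξ h
    obtain ⟨h1, h2⟩ := x1_of_zero H h
    rw [Equiv.Perm.mul_apply, Equiv.Perm.mul_apply, (h2.pow h1 m).2]
    simp
  refine Equiv.Perm.Disjoint.commute fun ξ => ?_
  by_cases h : IsPref v ξ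
  · right
    apply hfix
    obtain ⟨ζ, hζ⟩ := exists_cons (ρ⁻¹ ξ)
    cases hb : (ρ⁻¹ ξ) 0
    · rfl
    · rw [hb, Equiv.Perm.inv_eq_iff_eq] at hζ
      exact (hρ ζ (hζ ▸ h)).elim
  · exact .inl (hfix (hσ.inv_apply_zero h))

/-- Linear divergence, with explicit constants. -/
lemma exists_conn {g1 g2 : VPerm} (hg1 : g1 ∈ Subgroup.closure {x0, x1, c1, pi0})
    (hg2 : g2 ∈ Subgroup.closure {x0, x1, c1, pi0}) {B M : ℕ}
    (hB1 : 2 * B ≤ wlen {x0, x1, c1, pi0} g1 + 1) (hB2 : 2 * B ≤ wlen {x0, x1, c1, pi0} g2 + 1)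
    (hM : wlen {x0, x1, c1, pi0} g1 + wlen {x0, x1, c1, pi0} g2 = M) (hMpos : 0 < M) :
    ∃ n ≤ 10000 * M, Conn {x0, x1, c1, pi0} B g1 n g2 := by
  obtain ⟨h1, ω1, d1, C1, w1, hω1, hd1, hK1⟩ := exists_conn_logDeriv H hg1 hB1 (M + 8)
  obtain ⟨h2, ω2, d2, C2, w2, hω2, hd2, hK2⟩ := exists_conn_logDeriv H hg2 hB2 (M + 8)
  have hS := boundedLetters H
  set S : Set VPerm := {x0, x1, c1, pi0} with hSdef
  set z : CSeq := fun _ => false with hz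
  have hx0 : IsLetter S x0 := .inl (by simp [hSdef])
  have hx1 : IsLetter S x1 := .inl (by simp [hSdef])
  have hc1 : IsLetter S c1 := .inl (by simp [hSdef])
  obtain ⟨L, hL⟩ : ∃ L, L = 3 * M + 16 := ⟨_, rfl⟩
  obtain ⟨j, hj⟩ : ∃ j, j = 4 * L := ⟨_, rfl⟩
  obtain ⟨m, hm⟩ : ∃ m, m = M + 11 * L + 40 := ⟨_, rfl⟩
  set y := h2 * h1⁻¹ with hydef
  have hy : IsWord S L y := by
    rw [show L = wlen S g2 + (M + 8) + (wlen S g1 + (M + 8)) by omega]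
    exact w2.mul w1.inv
  set κ := x0 * (c1 * (c1 * x0)) with hκdef
  have hκ : IsWord S 4 κ := hx0.isWord.mul (hc1.isWord.mul (hc1.isWord.mul hx0.isWord))
  have hκm : Maps κ [true] [true, true, false] :=
    (H.x0_1 _).mul ((H.c1_0 _).mul ((H.c1_11 _).mul (H.x0_1 _)))
  set τ := x1 ^ j * κ with hτdef
  have hτ : IsWord S (j + 4) τ := (IsWord.pow hx1 j).mul hκ
  have hτm : Maps τ [true] (true :: true :: (List.replicate j true ++ [false])) :=
    (maps_x1_pow H j).mul hκm
  obtain ⟨σ, c, hσ, hσm, hdisj⟩ := exists_disjoint H hτm hy hj.ge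
  have hcomm := disjoint_conj_x1 H (ρ := y * τ) hσm hdisj m
  have hnz : ∀ v : List Bool, ¬ IsPref (true :: v) z := by
    rintro v ⟨ζ, hζ⟩
    have := congrFun hζ 0
    rw [app_apply_lt _ _ (by simp)] at this
    simp [hz] at this
  obtain ⟨hz1, hz1'⟩ := x1_of_zero H (ω := z) rfl
  obtain ⟨hp, hp'⟩ := x1_one H
  set p := app [true] z with hpdef
  have hh1 := w1.mem
  have hh2 := w2.mem
  -- from `h1` to `τ * x1 ^ m * τ⁻¹ * h1`
  have P1 : Conn S B h1 j (x1⁻¹ ^ j * h1) :=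
    Conn.of_pow hS hx1.inv hh1 hd1 (by omega)
      (by rw [hω1, Equiv.Perm.inv_eq_iff_eq, hz1])
      (by rw [hω1]; simpa using hz1'.inv_of_eq hz1) j
  have hk1 : x1⁻¹ ^ j * h1 ∈ Subgroup.closure S := mul_mem (pow_mem hx1.inv.mem j) hh1
  have hzi : x1⁻¹ z = z := by rw [Equiv.Perm.inv_eq_iff_eq, hz1]
  have hzi' : LogDeriv x1⁻¹ z 0 := by simpa using hz1'.inv_of_eq hz1
  have hkω : (x1⁻¹ ^ j * h1) ω1 = z := by
    rw [Equiv.Perm.mul_apply, hω1, (hzi'.pow hzi j).2]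
  have hkd : LogDeriv (x1⁻¹ ^ j * h1) ω1 d1 := by
    have := LogDeriv.mul (h := x1⁻¹ ^ j) (by rw [hω1]; exact (hzi'.pow hzi j).1) hd1
    rwa [mul_zero, zero_add] at this
  have hκz := x1_of_zero H (hκm.inv_apply_zero (hnz _))
  have P2 := Conn.of_conj (B := B) hS hκ hx1 hk1 hkd (by omega)
    (by rw [hkω]; exact hκz.1) (by rw [hkω]; exact hκz.2) m
  have hconjz : ∀ {ρ : VPerm} {v : List Bool} {ℓ : ℕ}, IsWord S ℓ ρ → Maps ρ [true] (true :: v) →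
      (ρ * x1 ^ m * ρ⁻¹) z = z ∧ LogDeriv (ρ * x1 ^ m * ρ⁻¹) z 0 := by
    intro ρ v ℓ hρ hρm
    obtain ⟨q1, q2⟩ := x1_of_zero H (hρm.inv_apply_zero (hnz _))
    obtain ⟨f, -, hf⟩ := hρ.logDeriv hS (ρ⁻¹ z)
    have := q2.conj q1 hf m
    have hρz : ρ (ρ⁻¹ z) = z := by simp
    rw [hρz] at this
    exact ⟨this.2, by simpa using this.1⟩
  have hk2 : κ * x1 ^ m * κ⁻¹ * (x1⁻¹ ^ j * h1) ∈ Subgroup.closure S :=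
    mul_mem (mul_mem (mul_mem hκ.mem (pow_mem hx1.mem m)) hκ.inv.mem) hk1
  have hk2ω : (κ * x1 ^ m * κ⁻¹ * (x1⁻¹ ^ j * h1)) ω1 = z := by
    rw [Equiv.Perm.mul_apply, hkω, (hconjz hκ hκm).1]
  have hk2d : LogDeriv (κ * x1 ^ m * κ⁻¹ * (x1⁻¹ ^ j * h1)) ω1 d1 := by
    have := LogDeriv.mul (h := κ * x1 ^ m * κ⁻¹) (by rw [hkω]; exact (hconjz hκ hκm).2) hkd
    rwa [zero_add] at this
  have P3 := Conn.of_pow (B := B) hS hx1 hk2 hk2d (by omega) (by rw [hk2ω, hz1])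
    (by rw [hk2ω]; exact hz1') j
  have hX : x1 ^ j * (κ * x1 ^ m * κ⁻¹ * (x1⁻¹ ^ j * h1)) = τ * x1 ^ m * τ⁻¹ * h1 := by
    rw [hτdef]; group
  rw [hX] at P3
  -- multiply by `y`
  set X := τ * x1 ^ m * τ⁻¹ with hXdef
  have hXmem : X ∈ Subgroup.closure S :=
    mul_mem (mul_mem hτ.mem (pow_mem hx1.mem m)) hτ.inv.mem
  obtain ⟨f, -, hf⟩ := hτ.logDeriv hS p
  obtain ⟨hXd, hXp⟩ := hp'.conj hp hf m
  obtain ⟨e, he, he'⟩ := w1.logDeriv hS (h1⁻¹ (τ p))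
  have hωp : h1 (h1⁻¹ (τ p)) = τ p := by simp
  have hXh : LogDeriv (X * h1) (h1⁻¹ (τ p)) (m * -1 + e) :=
    LogDeriv.mul (by rw [hωp]; exact hXd) he'
  have hXhp : (X * h1) (h1⁻¹ (τ p)) = τ p := by
    rw [Equiv.Perm.mul_apply, hωp, hXp]
  rw [abs_le] at he
  have P4 := Conn.of_isWord (B := B) hS hy (mul_mem hXmem hh1) hXh
    (by rw [abs_of_nonpos (by omega)]; omega)
  -- multiply by `σ * x1 ^ m * σ⁻¹`
  obtain ⟨e2, he2, he2'⟩ := hy.logDeriv hS (τ p)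
  have hyXh : LogDeriv (y * (X * h1)) (h1⁻¹ (τ p)) (e2 + (m * -1 + e)) :=
    LogDeriv.mul (by rw [hXhp]; exact he2') hXh
  have hyXhp : (y * (X * h1)) (h1⁻¹ (τ p)) = y (τ p) := by
    rw [Equiv.Perm.mul_apply, hXhp]
  rw [abs_le] at he2
  have hσy := x1_of_zero H (hσm.inv_apply_zero (hdisj z))
  have P5 := Conn.of_conj (B := B) hS hσ hx1 (mul_mem hy.mem (mul_mem hXmem hh1)) hyXh
    (by rw [abs_of_nonpos (by omega)]; omega) (by rw [hyXhp]; exact hσy.1)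
    (by rw [hyXhp]; exact hσy.2) m
  -- the same element, reached from `h2`
  have hσz := x1_of_zero H (hσm.inv_apply_zero (hnz _))
  have Q1 := Conn.of_conj (B := B) hS hσ hx1 hh2 hd2 (by omega)
    (by rw [hω2]; exact hσz.1) (by rw [hω2]; exact hσz.2) m
  set Y := σ * x1 ^ m * σ⁻¹ with hYdef
  have hYmem : Y ∈ Subgroup.closure S :=
    mul_mem (mul_mem hσ.mem (pow_mem hx1.mem m)) hσ.inv.mem
  obtain ⟨f', -, hf'⟩ := hσ.logDeriv hS p
  obtain ⟨hYd, hYp⟩ := hp'.conj hp hf' m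
  obtain ⟨e3, he3, he3'⟩ := w2.logDeriv hS (h2⁻¹ (σ p))
  have hωs : h2 (h2⁻¹ (σ p)) = σ p := by simp
  have hYh : LogDeriv (Y * h2) (h2⁻¹ (σ p)) (m * -1 + e3) :=
    LogDeriv.mul (by rw [hωs]; exact hYd) he3'
  have hYhp : (Y * h2) (h2⁻¹ (σ p)) = σ p := by
    rw [Equiv.Perm.mul_apply, hωs, hYp]
  rw [abs_le] at he3
  have hσp : ((y * τ)⁻¹ (σ p)) 0 = false := by
    obtain ⟨ζ, hζ⟩ := exists_cons ((y * τ)⁻¹ (σ p))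
    cases hb : ((y * τ)⁻¹ (σ p)) 0
    · rfl
    · rw [hb, Equiv.Perm.inv_eq_iff_eq] at hζ
      have h3 : IsPref [true, c] (σ p) := ⟨z, hσm z⟩
      rw [hζ] at h3
      exact (hdisj ζ h3).elim
  have hyτ := x1_of_zero H hσp
  have Q2 := Conn.of_conj (B := B) hS (hy.mul hτ) hx1 (mul_mem hYmem hh2) hYh
    (by rw [abs_of_nonpos (by omega)]; push_cast; omega) (by rw [hYhp]; exact hyτ.1)
    (by rw [hYhp]; exact hyτ.2) m
  have hmeet : y * τ * x1 ^ m * (y * τ)⁻¹ * (Y * h2) = Y * (y * (X * h1)) := by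
    rw [← mul_assoc, ← hcomm.eq, mul_assoc]
    congr 1
    rw [hXdef, hydef]
    group
  rw [hmeet] at Q2
  exact ⟨_, by omega, ((((((C1.trans P1).trans P2).trans P3).trans P4).trans P5).trans
    (Q1.trans Q2).symm).trans C2.symm⟩

end

lemma Nbr_one_le : Nbr 1 ≤ 1 := by
  refine Nat.sInf_le ⟨{([], [])}, ?_, ?_, by simp⟩
  · have h : ∀ ω : CSeq, IsPref [] ω := fun ω => ⟨ω, (app_nil ω).symm⟩
    refine ⟨fun ω => ⟨([], []), by simp [h], by simp⟩,
      fun ω => ⟨([], []), by simp [h], by simp⟩, ?_⟩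
    simp
  · simp [Reduced]

/-- There exist `δ, D > 0` such that for all `g1, g2 ∈ V`
with `N(g1), N(g2) ≥ 4` there is a word `w` in the letters
`x0^{±1}, x1^{±1}, c1^{±1}, π0^{±1}` of length at most
`D·(|g1|_C + |g2|_C)`, with `g1·w = g2` (left-to-right products) and
`|g1·w'|_C ≥ δ·min{|g1|_C, |g2|_C}` for every prefix `w'` of `w`. -/
theorem stmt19 (x0 x1 c1 pi0 : VPerm)
    (hx0 : Represents x0 x0T) (hx1 : Represents x1 x1T)
    (hc1 : Represents c1 c1T) (hpi0 : Represents pi0 pi0T) :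
    ∃ δ D : ℝ, 0 < δ ∧ 0 < D ∧
      ∀ g1 g2 : VPerm, InV g1 → InV g2 → 4 ≤ Nbr g1 → 4 ≤ Nbr g2 →
        ∃ w : List VPerm,
          (∀ x ∈ w, x = x0 ∨ x = x0⁻¹ ∨ x = x1 ∨ x = x1⁻¹ ∨
            x = c1 ∨ x = c1⁻¹ ∨ x = pi0 ∨ x = pi0⁻¹) ∧
          (w.length : ℝ) ≤
            D * ((wlen {x0, x1, c1, pi0} g1 : ℝ) + (wlen {x0, x1, c1, pi0} g2 : ℝ)) ∧
          wordEval g1 w = g2 ∧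
          (∀ w' : List VPerm, w' <+: w →
            δ * min (wlen {x0, x1, c1, pi0} g1 : ℝ) (wlen {x0, x1, c1, pi0} g2 : ℝ) ≤
              (wlen {x0, x1, c1, pi0} (wordEval g1 w') : ℝ)) := by
  have H : IsGens x0 x1 c1 pi0 := ⟨hx0, hx1, hc1, hpi0⟩
  refine ⟨1 / 2, 10000, by norm_num, by norm_num, fun g1 g2 hg1 hg2 hN1 hN2 => ?_⟩
  have m1 := mem_genGroup H hg1
  have m2 := mem_genGroup H hg2
  have hpos : 0 < wlen {x0, x1, c1, pi0} g1 := by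
    by_contra h0
    have hw := IsWord.wlen m1
    rw [Nat.eq_zero_of_not_pos h0] at hw
    obtain ⟨l, hl, -, rfl⟩ := hw
    rw [List.length_eq_zero_iff.mp hl, List.prod_nil] at hN1
    have := Nbr_one_le
    omega
  obtain ⟨B, hB⟩ : ∃ B,
      B = (min (wlen {x0, x1, c1, pi0} g1) (wlen {x0, x1, c1, pi0} g2) + 1) / 2 := ⟨_, rfl⟩
  obtain ⟨n, hn, hc⟩ := exists_conn H m1 m2 (B := B) (by omega) (by omega) rfl (by omega)
  obtain ⟨w, hw1, hw2, hw3, hw4⟩ := hc.exists_wordEval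
  refine ⟨w, fun x hx => ?_, ?_, hw3, fun w' hw' => ?_⟩
  · have := hw1 x hx
    simp only [IsLetter, Set.mem_insert_iff, Set.mem_singleton_iff, inv_eq_iff_eq_inv] at this
    tauto
  · rw [hw2]
    exact_mod_cast hn
  · have h1 : (min (wlen {x0, x1, c1, pi0} g1) (wlen {x0, x1, c1, pi0} g2) : ℕ) ≤
        2 * wlen {x0, x1, c1, pi0} (wordEval g1 w') := by
      have := hw4 w' hw'
      omega
    have h2 : ((min (wlen {x0, x1, c1, pi0} g1) (wlen {x0, x1, c1, pi0} g2) : ℕ) : ℝ) ≤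
        2 * wlen {x0, x1, c1, pi0} (wordEval g1 w') := by
      exact_mod_cast h1
    push_cast at h2
    linarith
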